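/- If an n-element finite meet-semilattice S has fewer than 28·2^{n-6} congruences, then it has at most 26·2^{n-6} congruences; moreover |Con(S)| = 26·2^{n-6} if and only if S is a quasi-tree semilattice whose nucleus is the pentagon lattice N₅. -/

import Mathlib

def IsMeetCong {α : Type*} [SemilatticeInf α] (s : Setoid α) : Prop :=
  ∀ a b c d : α, s.r a b → s.r c d → s.r (a ⊓ c) (b ⊓ d)

noncomputable def numCong (α : Type*) [SemilatticeInf α] : ℕ :=
  Nat.card {s : Setoid α // IsMeetCong s}

def IsUbta {α : Type*} [SemilatticeInf α] [OrderBot α] (x y : α) : Prop :=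
  x ≠ ⊥ ∧ y ≠ ⊥ ∧ ¬ x ≤ y ∧ ¬ y ≤ x ∧ ∃ z, x ≤ z ∧ y ≤ z

def treeCong (α : Type*) [SemilatticeInf α] [OrderBot α] : Setoid α :=
  sInf {s : Setoid α | IsMeetCong s ∧
    ∀ a b v : α, IsUbta a b → IsLUB {a, b} v → s.r (a ⊓ b) v}

def IsNucleus {α : Type*} [SemilatticeInf α] [OrderBot α] (X : Set α) : Prop :=
  (∃ x ∈ X, ∃ y ∈ X, x ≠ y) ∧
  (∀ x ∈ X, ∀ y, y ∈ X ↔ (treeCong α).r x y) ∧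
  (∀ a b : α, (treeCong α).r a b → a ≠ b → a ∈ X)

def IsQuasiTree (α : Type*) [SemilatticeInf α] [OrderBot α] : Prop :=
  ∃ X : Set α, IsNucleus X

/-- X is a copy of the pentagon N₅ = {u, a, c, b, v} with u < a < c < v,
u < b < v, and b incomparable to a and c. -/
def IsN5Nucleus {α : Type*} [SemilatticeInf α] (X : Set α) : Prop :=
  ∃ u a c b v : α, X = {u, a, c, b, v} ∧
    u < a ∧ a < c ∧ c < v ∧ u < b ∧ b < v ∧
    ¬ a ≤ b ∧ ¬ b ≤ a ∧ ¬ c ≤ b ∧ ¬ b ≤ c ∧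
    a ⊓ b = u ∧ c ⊓ b = u ∧ IsLUB {a, b} v ∧ IsLUB {c, b} v
section MeetCongruences

variable {α : Type*} [SemilatticeInf α]

theorem exists_isLUB_pair_of_le [Finite α] {a b z : α} (ha : a ≤ z) (hb : b ≤ z) :
    ∃ v, IsLUB {a, b} v := by
  obtain ⟨v, -, hv⟩ := (Set.toFinite {x : α | a ≤ x ∧ b ≤ x}).exists_le_minimal
    (a := z) ⟨ha, hb⟩
  refine ⟨v, by rintro x (rfl | rfl); exacts [hv.1.1, hv.1.2], fun w hw => ?_⟩
  have hw' : a ≤ w ∧ b ≤ w := ⟨hw (by simp), hw (by simp)⟩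
  exact (hv.2 (y := v ⊓ w) ⟨le_inf hv.1.1 hw'.1, le_inf hv.1.2 hw'.2⟩ inf_le_left).trans
    inf_le_right

/-- Two elements are related when the same members of `X` lie below them. -/
def belowSetoid (X : Finset α) : Setoid α where
  r x y := ∀ a ∈ X, a ≤ x ↔ a ≤ y
  iseqv := ⟨fun _ _ _ => Iff.rfl, fun h a ha => (h a ha).symm,
    fun h h' a ha => (h a ha).trans (h' a ha)⟩

theorem isMeetCong_belowSetoid (X : Finset α) : IsMeetCong (belowSetoid X) := by
  intro a b c d h h' x hx
  rw [le_inf_iff, le_inf_iff, h x hx, h' x hx]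

theorem IsMeetCong.exists_least [Finite α] {s : Setoid α} (hs : IsMeetCong s) (x : α) :
    ∃ m ≤ x, s.r m x ∧ ∀ p q, s.r p q → m ≤ p → m ≤ q := by
  obtain ⟨m, hmx, hm⟩ := (Set.toFinite {y : α | s.r y x}).exists_le_minimal
    (a := x) (s.refl x)
  refine ⟨m, hmx, hm.1, fun p q hpq hmp => ?_⟩
  have h1 : s.r (m ⊓ q) x := by
    have := hs m m q p (s.refl m) (s.symm hpq)
    rw [inf_eq_left.2 hmp] at this
    exact s.trans this hm.1
  exact (hm.2 h1 inf_le_left).trans inf_le_right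

/-- The equivalence collapsing `X` and nothing else. -/
def collapseSetoid (X : Set α) : Setoid α where
  r x y := x = y ∨ (x ∈ X ∧ y ∈ X)
  iseqv := ⟨fun _ => Or.inl rfl, by rintro x y (rfl | h); exacts [Or.inl rfl, Or.inr h.symm], by
    rintro x y z (rfl | h) (rfl | h')
    exacts [Or.inl rfl, Or.inr h', Or.inr h, Or.inr ⟨h.1, h'.2⟩]⟩

theorem isMeetCong_of_right {s : Setoid α}
    (h : ∀ x y z, s.r x y → s.r (x ⊓ z) (y ⊓ z)) : IsMeetCong s := by
  intro a b c d hab hcd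
  have h2 := h c d b hcd
  rw [inf_comm c, inf_comm d] at h2
  exact s.trans (h a b c hab) h2

theorem isMeetCong_collapseSetoid_Icc {u v : α} (hu : ∀ w, w ≤ v → u ≤ w ∨ w ≤ u) :
    IsMeetCong (collapseSetoid (Set.Icc u v)) := by
  apply isMeetCong_of_right
  rintro x y z (rfl | ⟨hx, hy⟩)
  · exact Or.inl rfl
  rcases hu (v ⊓ z) inf_le_left with h | h
  · have hz : u ≤ z := h.trans inf_le_right
    exact Or.inr ⟨⟨le_inf hx.1 hz, inf_le_left.trans hx.2⟩, le_inf hy.1 hz, inf_le_left.trans hy.2⟩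
  · have key : ∀ t ∈ Set.Icc u v, t ⊓ z = u ⊓ z := fun t ht => le_antisymm
      (le_inf ((inf_le_inf_right z ht.2).trans h) inf_le_right) (inf_le_inf_right z ht.1)
    exact Or.inl ((key x hx).trans (key y hy).symm)

end MeetCongruences

section JoinConstraints

variable {α : Type*} [SemilatticeInf α] [OrderBot α]

/-- `v` is the join of the incomparable bounded pair `a`, `b`. -/
def IsUbtaJoin (a b v : α) : Prop := IsUbta a b ∧ IsLUB {a, b} v

theorem IsUbtaJoin.symm {a b v : α} (h : IsUbtaJoin a b v) : IsUbtaJoin b a v := by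
  obtain ⟨⟨ha, hb, hab, hba, z, hz⟩, hv⟩ := h
  exact ⟨⟨hb, ha, hba, hab, z, hz.symm⟩, Set.pair_comm a b ▸ hv⟩

theorem IsUbtaJoin.le_left {a b v : α} (h : IsUbtaJoin a b v) : a ≤ v := h.2.1 (by simp)

theorem IsUbtaJoin.le_right {a b v : α} (h : IsUbtaJoin a b v) : b ≤ v := h.2.1 (by simp)

theorem IsUbtaJoin.ne {a b v : α} (h : IsUbtaJoin a b v) :
    a ≠ ⊥ ∧ b ≠ ⊥ ∧ v ≠ ⊥ ∧ a ≠ b ∧ a ≠ v ∧ b ≠ v := by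
  have h1 := h.le_left
  have h2 := h.le_right
  obtain ⟨⟨ha, hb, hab, hba, -⟩, -⟩ := h
  refine ⟨ha, hb, ?_, ?_, ?_, ?_⟩
  · rintro rfl; exact ha (le_bot_iff.1 h1)
  · rintro rfl; exact hab le_rfl
  · rintro rfl; exact hba h2
  · rintro rfl; exact hab h1

theorem exists_isUbtaJoin [Finite α] {a b z : α} (hab : ¬ a ≤ b) (hba : ¬ b ≤ a)
    (ha : a ≤ z) (hb : b ≤ z) : ∃ v, IsUbtaJoin a b v := by
  obtain ⟨v, hv⟩ := exists_isLUB_pair_of_le ha hb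
  refine ⟨v, ⟨?_, ?_, hab, hba, z, ha, hb⟩, hv⟩
  · rintro rfl; exact hab bot_le
  · rintro rfl; exact hba bot_le

/-- `X` contains `⊥` and is closed under the existing binary joins. -/
def IsJoinClosed (X : Finset α) : Prop :=
  ⊥ ∈ X ∧ ∀ a b v : α, IsUbtaJoin a b v → a ∈ X → b ∈ X → v ∈ X

theorem IsJoinClosed.mem_of_isLUB {X : Finset α} (hX : IsJoinClosed X) {a b v : α}
    (ha : a ∈ X) (hb : b ∈ X) (hv : IsLUB {a, b} v) : v ∈ X := by
  have h1 : a ≤ v := hv.1 (by simp)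
  have h2 : b ≤ v := hv.1 (by simp)
  by_cases hab : a ≤ b
  · have : v ≤ b := hv.2 (by rintro x (rfl | rfl); exacts [hab, le_rfl])
    rwa [← le_antisymm h2 this]
  by_cases hba : b ≤ a
  · have : v ≤ a := hv.2 (by rintro x (rfl | rfl); exacts [le_rfl, hba])
    rwa [← le_antisymm h1 this]
  refine hX.2 a b v ⟨⟨?_, ?_, hab, hba, v, h1, h2⟩, hv⟩ ha hb
  · rintro rfl; exact hab bot_le
  · rintro rfl; exact hba bot_le

theorem IsJoinClosed.mem_iff [Finite α] {X : Finset α} (hX : IsJoinClosed X) (b : α) :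
    b ∈ X ↔ ∀ x y, (belowSetoid X).r x y → (b ≤ x ↔ b ≤ y) := by
  refine ⟨fun hb x y h => h b hb, fun h => ?_⟩
  obtain ⟨m, -, hm⟩ := (Set.toFinite {x : α | x ∈ X ∧ x ≤ b}).exists_le_maximal
    (a := ⊥) ⟨hX.1, bot_le⟩
  have key : ∀ a ∈ X, a ≤ b → a ≤ m := by
    intro a ha hab
    obtain ⟨v, hv⟩ := exists_isLUB_pair_of_le hab hm.1.2
    have hvb : v ≤ b := hv.2 (by rintro x (rfl | rfl); exacts [hab, hm.1.2])
    exact (hv.1 (by simp)).trans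
      (hm.2 ⟨hX.mem_of_isLUB ha hm.1.1 hv, hvb⟩ (hv.1 (by simp)))
  have hbm : b ≤ m := (h b m fun a ha => ⟨key a ha, fun h => h.trans hm.1.2⟩).1 le_rfl
  rw [le_antisymm hbm hm.1.2]
  exact hm.1.1

open Classical in
theorem numCong_eq_card_joinClosed [Fintype α] :
    numCong α = (Finset.univ.filter fun X : Finset α => IsJoinClosed X).card := by
  rw [numCong, ← Fintype.card_subtype, ← Nat.card_eq_fintype_card]
  symm
  refine Nat.card_eq_of_bijective
    (fun X : {X : Finset α // IsJoinClosed X} =>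
      (⟨belowSetoid X.1, isMeetCong_belowSetoid X.1⟩ : {s : Setoid α // IsMeetCong s})) ⟨?_, ?_⟩
  · rintro ⟨X, hX⟩ ⟨Y, hY⟩ h
    have h' : belowSetoid X = belowSetoid Y := congrArg Subtype.val h
    apply Subtype.ext
    ext b
    rw [hX.mem_iff, hY.mem_iff, h']
  · rintro ⟨s, hs⟩
    refine ⟨⟨Finset.univ.filter fun b => ∀ x y, s.r x y → (b ≤ x ↔ b ≤ y), by simp, ?_⟩, ?_⟩
    · intro a b v hv ha hb
      simp only [Finset.mem_filter, Finset.mem_univ, true_and] at ha hb ⊢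
      intro x y hxy
      have hle : ∀ z, v ≤ z ↔ a ≤ z ∧ b ≤ z := fun z => by
        rw [isLUB_le_iff hv.2]; simp [upperBounds]
      rw [hle, hle, ha x y hxy, hb x y hxy]
    · apply Subtype.ext
      ext x y
      refine ⟨fun h => ?_, fun h a ha => (Finset.mem_filter.1 ha).2 x y h⟩
      have key : ∀ x y, (∀ a, (∀ p q, s.r p q → (a ≤ p ↔ a ≤ q)) → a ≤ x → a ≤ y) →
          s.r x (x ⊓ y) := by
        intro x y h
        obtain ⟨m, hmx, hmr, hm⟩ := hs.exists_least x
        have hmy : m ≤ y := h m (fun p q hpq => ⟨hm p q hpq, hm q p (s.symm hpq)⟩) hmx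
        have := hs m x y y hmr (s.refl y)
        rw [inf_eq_left.2 hmy] at this
        exact s.trans (s.symm hmr) this
      have h' : ∀ a, (∀ p q, s.r p q → (a ≤ p ↔ a ≤ q)) → (a ≤ x ↔ a ≤ y) :=
        fun a ha => h a (by simpa using ha)
      have h1 := key x y fun a ha => (h' a ha).1
      have h2 := key y x fun a ha => (h' a ha).2
      rw [inf_comm] at h2
      exact s.trans h1 (s.symm h2)

end JoinConstraints

section Counting

open Finset

theorem two_pow_mul_card_Icc_compl {α : Type*} [Fintype α] [DecidableEq α] {A B : Finset α}
    (h : Disjoint A B) : 2 ^ (#A + #B) * #(Icc A Bᶜ) = 2 ^ Fintype.card α := by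
  have hle : #A + #B ≤ Fintype.card α := by
    rw [← card_union_of_disjoint h]; exact card_le_univ _
  rw [card_Icc_finset (le_compl_iff_disjoint_right.2 h), card_compl, ← pow_add]
  congr 1
  omega

variable {α : Type*} [SemilatticeInf α] [OrderBot α] [Fintype α] [DecidableEq α]

/-- The sets containing `⊥`, `a` and `b`, but not `v`. -/
def violators (a b v : α) : Finset (Finset α) := Icc {⊥, a, b} {v}ᶜ

theorem mem_violators {a b v : α} {X : Finset α} :
    X ∈ violators a b v ↔ ⊥ ∈ X ∧ a ∈ X ∧ b ∈ X ∧ v ∉ X := by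
  simp [violators, mem_Icc, insert_subset_iff, subset_compl_iff_disjoint_right, and_assoc]

theorem violators_comm (a b v : α) : violators a b v = violators b a v := by
  ext X; simp only [mem_violators]; tauto

theorem IsUbtaJoin.card_violators {a b v : α} (h : IsUbtaJoin a b v) :
    64 * #(violators a b v) = 4 * 2 ^ Fintype.card α := by
  obtain ⟨ha, hb, hv, hab, hav, hbv⟩ := h.ne
  have hd : Disjoint ({⊥, a, b} : Finset α) {v} := by
    simp [hav.symm, hbv.symm, hv]
  have := two_pow_mul_card_Icc_compl hd
  rw [card_singleton, card_eq_three.2 ⟨⊥, a, b, ha.symm, hb.symm, hab, rfl⟩] at this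
  rw [violators]
  omega

theorem violators_inter (a b v c d w : α) :
    violators a b v ∩ violators c d w = Icc {⊥, a, b, c, d} {v, w}ᶜ := by
  ext X
  simp only [mem_inter, mem_violators, mem_Icc, insert_subset_iff,
    singleton_subset_iff, subset_compl_iff_disjoint_left, disjoint_insert_left,
    disjoint_singleton_left]
  tauto

theorem card_violators_inter_of_common {a b c v : α} (h : IsUbtaJoin a b v)
    (h' : IsUbtaJoin c b v) (hac : a ≠ c) :
    64 * #(violators a b v ∩ violators c b v) = 2 * 2 ^ Fintype.card α := by
  obtain ⟨ha, hb, hv, hab, hav, hbv⟩ := h.ne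
  obtain ⟨hc, -, -, hcb, hcv, -⟩ := h'.ne
  have hA : ({⊥, a, b, c, b} : Finset α) = {⊥, a, b, c} := by ext x; simp; tauto
  have hd : Disjoint ({⊥, a, b, c} : Finset α) {v} := by
    simp [hv, hav.symm, hbv.symm, hcv.symm]
  have hcard : #({⊥, a, b, c} : Finset α) = 4 :=
    card_eq_four.2 ⟨⊥, a, b, c, ha.symm, hb.symm, hc.symm, hab, hac, hcb.symm, rfl⟩
  have := two_pow_mul_card_Icc_compl hd
  rw [card_singleton, hcard] at this
  rw [violators_inter, hA, pair_eq_singleton]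
  omega

theorem card_violators_inter_le {a b c d v w : α} (h : IsUbtaJoin a b v)
    (h' : IsUbtaJoin c d w) (hca : c ≠ a) (hcb : c ≠ b)
    (hvw : v ≠ w ∨ (d ≠ a ∧ d ≠ b)) :
    64 * #(violators a b v ∩ violators c d w) ≤ 2 ^ Fintype.card α := by
  obtain ⟨ha, hb, hv, hab, hav, hbv⟩ := h.ne
  obtain ⟨hc, hd, hw, hcd, hcw, hdw⟩ := h'.ne
  rw [violators_inter]
  by_cases hdis : Disjoint ({⊥, a, b, c, d} : Finset α) {v, w}
  · rw [← two_pow_mul_card_Icc_compl hdis]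
    suffices 6 ≤ #({⊥, a, b, c, d} : Finset α) + #({v, w} : Finset α) from
      Nat.mul_le_mul_right _ (Nat.pow_le_pow_right two_pos this)
    have h4 : #({⊥, a, b, c} : Finset α) = 4 :=
      card_eq_four.2 ⟨⊥, a, b, c, ha.symm, hb.symm, hc.symm, hab, hca.symm, hcb.symm, rfl⟩
    by_cases hvw' : v = w
    · have h2 : d ≠ a ∧ d ≠ b := hvw.resolve_left (not_not.2 hvw')
      have hA : ({⊥, a, b, c, d} : Finset α) = insert d {⊥, a, b, c} := by
        ext x; simp; tauto
      rw [hA, card_insert_of_notMem (by simp [hd, h2.1, h2.2, hcd.symm]), h4]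
      have : 0 < #({v, w} : Finset α) := card_pos.2 ⟨v, by simp⟩
      omega
    · rw [card_pair hvw']
      have : #({⊥, a, b, c} : Finset α) ≤ #({⊥, a, b, c, d} : Finset α) :=
        card_le_card (by intro x; simp; tauto)
      omega
  · rw [Icc_eq_empty, card_empty]
    · exact Nat.zero_le _
    · rwa [subset_compl_iff_disjoint_right]

end Counting

section Gap

open Finset

variable {α : Type*} [SemilatticeInf α] [OrderBot α]

/-- The incomparable bounded pairs are exactly `{a, b}` and `{c, b}`, with common join `v`. -/
structure IsTwoPairConfig (a b c v : α) : Prop where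
  left : IsUbtaJoin a b v
  right : IsUbtaJoin c b v
  ne : a ≠ c
  only : ∀ x y w : α, IsUbtaJoin x y w →
    (x = a ∧ y = b) ∨ (x = b ∧ y = a) ∨ (x = c ∧ y = b) ∨ (x = b ∧ y = c)

theorem IsTwoPairConfig.swap {a b c v : α} (h : IsTwoPairConfig a b c v) :
    IsTwoPairConfig c b a v :=
  ⟨h.right, h.left, h.ne.symm, fun x y w hw => by have := h.only x y w hw; tauto⟩

variable [Fintype α]

theorem exists_card_add_numCong (α : Type*) [SemilatticeInf α] [OrderBot α] [Fintype α]
    [DecidableEq α] : ∃ bad : Finset (Finset α),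
      64 * #bad + 64 * numCong α = 32 * 2 ^ Fintype.card α ∧
      ∀ X, X ∈ bad ↔ ∃ a b v, IsUbtaJoin a b v ∧ X ∈ violators a b v := by
  classical
  refine ⟨univ.filter fun X => ∃ a b v, IsUbtaJoin a b v ∧ X ∈ violators a b v, ?_, by simp⟩
  rw [numCong_eq_card_joinClosed, ← mul_add, ← card_union_of_disjoint]
  · have hK : (univ.filter fun X => ∃ a b v, IsUbtaJoin a b v ∧ X ∈ violators a b v) ∪
        (univ.filter fun X : Finset α => IsJoinClosed X) = Icc {⊥} (∅ : Finset α)ᶜ := by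
      ext X
      simp only [mem_union, mem_filter, mem_univ, true_and, mem_violators,
        compl_empty, mem_Icc, singleton_subset_iff, subset_univ, and_true]
      rw [IsJoinClosed]
      constructor
      · rintro (⟨a, b, v, -, h, -⟩ | ⟨h, -⟩) <;> exact h
      · intro h
        by_contra! hcon
        obtain ⟨a, b, v, hv, ha, hb, hvX⟩ := hcon.2 h
        exact hvX (hcon.1 a b v hv h ha hb)
    have := two_pow_mul_card_Icc_compl (disjoint_empty_right ({⊥} : Finset α))
    rw [card_singleton, card_empty] at this
    rw [hK]
    omega
  · rw [Finset.disjoint_left]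
    simp only [mem_filter, mem_univ, true_and, mem_violators]
    rintro X ⟨a, b, v, hv, -, ha, hb, hvX⟩ hX
    exact hvX (hX.2 a b v hv ha hb)

theorem IsTwoPairConfig.numCong_eq {a b c v : α} (h : IsTwoPairConfig a b c v) :
    64 * numCong α = 26 * 2 ^ Fintype.card α := by
  classical
  obtain ⟨bad, hcard, hbad⟩ := exists_card_add_numCong α
  have hE : bad = violators a b v ∪ violators c b v := by
    ext X
    rw [hbad, mem_union]
    constructor
    · rintro ⟨x, y, w, hw, hX⟩
      have hjoin : ∀ {p q r s : α}, IsUbtaJoin p q r → IsUbtaJoin p q s → r = s :=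
        fun h h' => h.2.unique h'.2
      rcases h.only x y w hw with ⟨rfl, rfl⟩ | ⟨rfl, rfl⟩ | ⟨rfl, rfl⟩ | ⟨rfl, rfl⟩
      · left; rwa [hjoin h.left hw]
      · left; rwa [hjoin h.left hw.symm, violators_comm]
      · right; rwa [hjoin h.right hw]
      · right; rwa [hjoin h.right hw.symm, violators_comm]
    · rintro (hX | hX)
      exacts [⟨a, b, v, h.left, hX⟩, ⟨c, b, v, h.right, hX⟩]
  have h1 := card_union_add_card_inter (violators a b v) (violators c b v)
  have h2 := card_violators_inter_of_common h.left h.right h.ne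
  have h3 := h.left.card_violators
  have h4 := h.right.card_violators
  rw [hE] at hcard
  omega

theorem numCong_of_common_pairs {a b c v : α} (h : IsUbtaJoin a b v)
    (h' : IsUbtaJoin c b v) (hac : a ≠ c) :
    64 * numCong α ≤ 26 * 2 ^ Fintype.card α ∧
      (64 * numCong α = 26 * 2 ^ Fintype.card α → IsTwoPairConfig a b c v) := by
  classical
  obtain ⟨bad, hcard, hbad⟩ := exists_card_add_numCong α
  have hE : violators a b v ∪ violators c b v ⊆ bad := by
    intro X hX
    rcases mem_union.1 hX with hX | hX
    exacts [(hbad X).2 ⟨_, _, _, h, hX⟩, (hbad X).2 ⟨_, _, _, h', hX⟩]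
  have h1 := card_union_add_card_inter (violators a b v) (violators c b v)
  have h2 := card_violators_inter_of_common h h' hac
  have h3 := h.card_violators
  have h4 := h'.card_violators
  have h5 := card_le_card hE
  refine ⟨by omega, fun heq => ⟨h, h', hac, fun x y w hw => ?_⟩⟩
  have hEq := eq_of_subset_of_card_le hE (by omega)
  obtain ⟨hx, hy, hw0, hxy, hxw, hyw⟩ := hw.ne
  have hX : ({⊥, x, y} : Finset α) ∈ bad := (hbad _).2 ⟨x, y, w, hw,
    mem_violators.2 (by simp [hw0, hxw.symm, hyw.symm])⟩
  obtain ⟨ha, hb, -, hab, -⟩ := h.ne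
  obtain ⟨hc, -, -, hcb, -⟩ := h'.ne
  rw [← hEq, mem_union, mem_violators, mem_violators] at hX
  simp only [mem_insert, mem_singleton, ha, hb, hc, false_or, true_or, true_and] at hX
  grind

theorem numCong_lt_of_pairs {a b c d v w : α} (h : IsUbtaJoin a b v)
    (h' : IsUbtaJoin c d w) (hca : c ≠ a) (hcb : c ≠ b)
    (hvw : v ≠ w ∨ (d ≠ a ∧ d ≠ b)) :
    64 * numCong α < 26 * 2 ^ Fintype.card α := by
  classical
  obtain ⟨bad, hcard, hbad⟩ := exists_card_add_numCong α
  have hE : violators a b v ∪ violators c d w ⊆ bad := by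
    intro X hX
    rcases mem_union.1 hX with hX | hX
    exacts [(hbad X).2 ⟨_, _, _, h, hX⟩, (hbad X).2 ⟨_, _, _, h', hX⟩]
  have h1 := card_union_add_card_inter (violators a b v) (violators c d w)
  have h2 := card_violators_inter_le h h' hca hcb hvw
  have h3 := h.card_violators
  have h4 := h'.card_violators
  have h5 := card_le_card hE
  have h6 : 0 < 2 ^ Fintype.card α := by positivity
  omega

theorem numCong_of_new_element {a b c d v w : α} (h : IsUbtaJoin a b v)
    (h' : IsUbtaJoin c d w) (hca : c ≠ a) (hcb : c ≠ b) :
    64 * numCong α ≤ 26 * 2 ^ Fintype.card α ∧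
      (64 * numCong α = 26 * 2 ^ Fintype.card α → ∃ a b c v : α, IsTwoPairConfig a b c v) := by
  by_cases hvw : v ≠ w ∨ (d ≠ a ∧ d ≠ b)
  · have := numCong_lt_of_pairs h h' hca hcb hvw
    exact ⟨this.le, fun heq => absurd heq this.ne⟩
  · push Not at hvw
    obtain ⟨rfl, hd⟩ := hvw
    by_cases hda : d = a
    · subst hda
      have := numCong_of_common_pairs h.symm h' hcb.symm
      exact ⟨this.1, fun heq => ⟨_, _, _, _, this.2 heq⟩⟩
    · obtain rfl := hd hda
      have := numCong_of_common_pairs h h' hca.symm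
      exact ⟨this.1, fun heq => ⟨_, _, _, _, this.2 heq⟩⟩

theorem numCong_dichotomy (hlt : 64 * numCong α < 28 * 2 ^ Fintype.card α) :
    64 * numCong α ≤ 26 * 2 ^ Fintype.card α ∧
      (64 * numCong α = 26 * 2 ^ Fintype.card α → ∃ a b c v : α, IsTwoPairConfig a b c v) := by
  classical
  by_cases hex : ∃ a b v : α, IsUbtaJoin a b v
  · obtain ⟨a, b, v, h⟩ := hex
    by_cases hnew : ∃ c d w : α, IsUbtaJoin c d w ∧ c ≠ a ∧ c ≠ b
    · obtain ⟨c, d, w, h', hca, hcb⟩ := hnew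
      exact numCong_of_new_element h h' hca hcb
    · exfalso
      push Not at hnew
      obtain ⟨bad, hcard, hbad⟩ := exists_card_add_numCong α
      have hsub : bad ⊆ violators a b v := by
        intro X hX
        obtain ⟨x, y, w, hw, hX⟩ := (hbad X).1 hX
        have h1 := hnew x y w hw
        have h2 := hnew y x w hw.symm
        have h3 := hw.ne.2.2.2.1
        have hcase : (x = a ∧ y = b) ∨ (x = b ∧ y = a) := by grind
        rcases hcase with ⟨rfl, rfl⟩ | ⟨rfl, rfl⟩
        · rwa [h.2.unique hw.2]
        · rwa [h.2.unique hw.symm.2, violators_comm]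
      have h1 := card_le_card hsub
      have h2 := h.card_violators
      omega
  · exfalso
    obtain ⟨bad, hcard, hbad⟩ := exists_card_add_numCong α
    have hsub : bad = ∅ := by
      rw [eq_empty_iff_forall_notMem]
      intro X hX
      obtain ⟨x, y, w, hw, -⟩ := (hbad X).1 hX
      exact hex ⟨x, y, w, hw⟩
    rw [hsub, card_empty] at hcard
    omega

end Gap

section Nucleus

variable {α : Type*} [SemilatticeInf α] [OrderBot α]

theorem isMeetCong_treeCong : IsMeetCong (treeCong α) := by
  intro a b c d hab hcd s hs
  exact hs.1 a b c d (hab s hs) (hcd s hs)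

theorem IsUbtaJoin.treeCong_inf {a b v : α} (h : IsUbtaJoin a b v) :
    (treeCong α).r (a ⊓ b) v :=
  fun _ hs => hs.2 a b v h.1 h.2

theorem IsUbtaJoin.treeCong_left {a b v : α} (h : IsUbtaJoin a b v) : (treeCong α).r a v := by
  have h1 := isMeetCong_treeCong a a _ _ ((treeCong α).refl a) h.treeCong_inf
  rw [← inf_assoc, inf_idem, inf_eq_left.2 h.le_left] at h1
  exact (treeCong α).trans ((treeCong α).symm h1) h.treeCong_inf

theorem IsNucleus.mem_of_isUbtaJoin {X : Set α} (hX : IsNucleus X) {a b v : α}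
    (h : IsUbtaJoin a b v) : a ∈ X :=
  hX.2.2 a v h.treeCong_left h.ne.2.2.2.2.1

theorem IsNucleus.exists_isTwoPairConfig {X : Set α} (hX : IsNucleus X)
    (hN : IsN5Nucleus X) : ∃ a b c v : α, IsTwoPairConfig a b c v := by
  obtain ⟨u, a, c, b, v, rfl, hua, hac, hcv, hub, hbv, hab, hba, hcb, hbc, -, -, hl, hl'⟩ := hN
  refine ⟨a, b, c, v,
    ⟨⟨(bot_le.trans_lt hua).ne', (bot_le.trans_lt hub).ne', hab, hba, v,
      (hac.trans hcv).le, hbv.le⟩, hl⟩,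
    ⟨⟨(bot_le.trans_lt (hua.trans hac)).ne', (bot_le.trans_lt hub).ne', hcb, hbc, v,
      hcv.le, hbv.le⟩, hl'⟩, hac.ne, fun x y w hw => ?_⟩
  have hx := hX.mem_of_isUbtaJoin hw
  have hy := hX.mem_of_isUbtaJoin hw.symm
  have hxy := hw.1.2.2.1
  have hyx := hw.1.2.2.2.1
  simp only [Set.mem_insert_iff, Set.mem_singleton_iff] at hx hy
  have := hac.le
  have := hua.le
  have := hub.le
  have := hcv.le
  have := hbv.le
  have := hua.le.trans hac.le
  have := hac.le.trans hcv.le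
  have := hub.le.trans hbv.le
  rcases hx with rfl | rfl | rfl | rfl | rfl <;>
    rcases hy with rfl | rfl | rfl | rfl | rfl <;> first | contradiction | simp_all

theorem IsTwoPairConfig.lt_or_lt [Finite α] {a b c v : α} (h : IsTwoPairConfig a b c v) :
    a < c ∨ c < a := by
  have hab := h.left.ne.2.2.2.1
  have hcb := h.right.ne.2.2.2.1
  by_contra! hcon
  obtain ⟨w, hw⟩ := exists_isUbtaJoin (fun hle => hcon.1 (lt_of_le_of_ne hle h.ne))
    (fun hle => hcon.2 (lt_of_le_of_ne hle h.ne.symm)) h.left.le_left h.right.le_left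
  have := h.only a c w hw
  have := h.ne
  grind

theorem IsTwoPairConfig.comparable [Finite α] {a b c v x y z : α} (h : IsTwoPairConfig a b c v)
    (hx : x ≤ z) (hy : y ≤ z) (hxa : x ≠ a) (hxb : x ≠ b) (hxc : x ≠ c) : x ≤ y ∨ y ≤ x := by
  by_contra! hcon
  obtain ⟨w, hw⟩ := exists_isUbtaJoin hcon.1 hcon.2 hx hy
  rcases h.only x y w hw with h | h | h | h <;> simp_all

theorem IsTwoPairConfig.inf_eq [Finite α] {a b c v : α} (h : IsTwoPairConfig a b c v)
    (hac : a < c) : c ⊓ b = a ⊓ b := by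
  refine le_antisymm ?_ (inf_le_inf_right b hac.le)
  refine le_inf ?_ inf_le_right
  by_contra hd
  have hd' : ¬ a ≤ c ⊓ b := fun hle => h.left.1.2.2.1 (hle.trans inf_le_right)
  rcases h.comparable (x := c ⊓ b) (y := a) (z := c) inf_le_left hac.le
    (fun he => hd he.le) (fun he => h.right.1.2.2.2.1 (inf_eq_right.1 he))
    (fun he => h.right.1.2.2.1 (inf_eq_left.1 he)) with h' | h'
  exacts [hd h', hd' h']

theorem IsTwoPairConfig.Icc_eq [Finite α] {a b c v : α} (h : IsTwoPairConfig a b c v)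
    (hac : a < c) : Set.Icc (a ⊓ b) v = {a ⊓ b, a, c, b, v} := by
  ext x
  simp only [Set.mem_Icc, Set.mem_insert_iff, Set.mem_singleton_iff]
  constructor
  · rintro ⟨hux, hxv⟩
    by_contra! hcon
    obtain ⟨hxu, hxa, hxc, hxb, hxv'⟩ := hcon
    have ha := h.comparable hxv h.left.le_left hxa hxb hxc
    have hb := h.comparable hxv h.left.le_right hxa hxb hxc
    have hab := h.left.1.2.2.1
    have hba := h.left.1.2.2.2.1
    rcases ha with ha | ha <;> rcases hb with hb | hb
    · exact hxu (le_antisymm (le_inf ha hb) hux)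
    · exact hba (hb.trans ha)
    · exact hab (ha.trans hb)
    · exact hxv' (le_antisymm hxv (h.left.2.2 (by rintro y (rfl | rfl) <;> assumption)))
  · rintro (rfl | rfl | rfl | rfl | rfl)
    · exact ⟨le_rfl, inf_le_left.trans h.left.le_left⟩
    · exact ⟨inf_le_left, h.left.le_left⟩
    · exact ⟨inf_le_left.trans hac.le, h.right.le_left⟩
    · exact ⟨inf_le_right, h.left.le_right⟩
    · exact ⟨inf_le_left.trans h.left.le_left, le_rfl⟩

theorem IsTwoPairConfig.treeCong_iff [Finite α] {a b c v : α} (h : IsTwoPairConfig a b c v)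
    (hac : a < c) (x y : α) : (treeCong α).r x y ↔
      x = y ∨ (x ∈ Set.Icc (a ⊓ b) v ∧ y ∈ Set.Icc (a ⊓ b) v) := by
  have huv : a ⊓ b ≤ v := inf_le_left.trans h.left.le_left
  constructor
  · intro hxy
    refine hxy (collapseSetoid (Set.Icc (a ⊓ b) v))
      ⟨isMeetCong_collapseSetoid_Icc fun w hw => ?_, fun p q r hpq hr => ?_⟩
    · exact h.comparable huv hw (fun he => h.left.1.2.2.1 (inf_eq_left.1 he))
        (fun he => h.left.1.2.2.2.1 (inf_eq_right.1 he))
        (fun he => hac.not_ge (he ▸ inf_le_left))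
    · refine Or.inr ?_
      have hJ : IsUbtaJoin p q r := ⟨hpq, hr⟩
      have hcu := h.inf_eq hac
      rcases h.only p q r hJ with ⟨rfl, rfl⟩ | ⟨rfl, rfl⟩ | ⟨rfl, rfl⟩ | ⟨rfl, rfl⟩
      · rw [hJ.2.unique h.left.2]; simp [huv]
      · rw [hJ.symm.2.unique h.left.2, inf_comm p q]; simp [huv]
      · rw [hJ.2.unique h.right.2, hcu]; simp [huv]
      · rw [hJ.symm.2.unique h.right.2, inf_comm p q, hcu]; simp [huv]
  · rintro (rfl | ⟨hx, hy⟩)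
    · exact (treeCong α).refl x
    · have key : ∀ t ∈ Set.Icc (a ⊓ b) v, (treeCong α).r (a ⊓ b) t := fun t ht => by
        have := isMeetCong_treeCong _ _ t t h.left.treeCong_inf ((treeCong α).refl t)
        rwa [inf_eq_left.2 ht.1, inf_eq_right.2 ht.2] at this
      exact (treeCong α).trans ((treeCong α).symm (key x hx)) (key y hy)

theorem IsTwoPairConfig.exists_nucleus_of_lt [Finite α] {a b c v : α}
    (h : IsTwoPairConfig a b c v) (hac : a < c) :
    ∃ X : Set α, IsNucleus X ∧ IsN5Nucleus X := by
  obtain ⟨-, -, -, -, hav, hbv⟩ := h.left.ne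
  have hcv := h.right.ne.2.2.2.2.1
  have hJ := h.left.1
  have hJ' := h.right.1
  have htree := h.treeCong_iff hac
  refine ⟨Set.Icc (a ⊓ b) v, ⟨?_, fun x hx y => ?_, fun x y hxy hne => ?_⟩, ?_⟩
  · exact ⟨a, ⟨inf_le_left, h.left.le_left⟩, v, ⟨inf_le_left.trans h.left.le_left, le_rfl⟩, hav⟩
  · rw [htree]
    exact ⟨fun hy => Or.inr ⟨hx, hy⟩, by rintro (rfl | hy); exacts [hx, hy.2]⟩
  · exact (((htree x y).1 hxy).resolve_left hne).1
  · exact ⟨a ⊓ b, a, c, b, v, h.Icc_eq hac, inf_lt_left.2 hJ.2.2.1, hac,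
      lt_of_le_of_ne h.right.le_left hcv, inf_lt_right.2 hJ.2.2.2.1,
      lt_of_le_of_ne h.left.le_right hbv, hJ.2.2.1, hJ.2.2.2.1, hJ'.2.2.1, hJ'.2.2.2.1,
      rfl, h.inf_eq hac, h.left.2, h.right.2⟩

theorem IsTwoPairConfig.exists_nucleus [Finite α] {a b c v : α}
    (h : IsTwoPairConfig a b c v) : ∃ X : Set α, IsNucleus X ∧ IsN5Nucleus X :=
  h.lt_or_lt.elim h.exists_nucleus_of_lt h.swap.exists_nucleus_of_lt

end Nucleus

/-- If |Con(S)| < 28·2^(n-6) then |Con(S)| ≤ 26·2^(n-6); moreover equality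
|Con(S)| = 26·2^(n-6) holds iff S is a quasi-tree semilattice with nucleus N₅
(all multiplied through by 2^6). -/
theorem numCong_third_gap {α : Type*} [SemilatticeInf α] [OrderBot α] [Fintype α]
    (hn : 2 ≤ Fintype.card α)
    (h : 2 ^ 6 * numCong α < 28 * 2 ^ Fintype.card α) :
    2 ^ 6 * numCong α ≤ 26 * 2 ^ Fintype.card α ∧
    (2 ^ 6 * numCong α = 26 * 2 ^ Fintype.card α ↔
      ∃ X : Set α, IsNucleus X ∧ IsN5Nucleus X) := by
  obtain ⟨hle, himp⟩ := numCong_dichotomy h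
  refine ⟨hle, fun heq => ?_, ?_⟩
  · obtain ⟨a, b, c, v, hcfg⟩ := himp heq
    exact hcfg.exists_nucleus
  · rintro ⟨X, hX, hN⟩
    obtain ⟨a, b, c, v, hcfg⟩ := hX.exists_isTwoPairConfig hN
    exact hcfg.numCong_eq
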